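/- Let K = ℂ(x₁,…,xₙ) and Ω an (n−1)-form over K. Let L₀ be an elementary extension of K, let t be transcendental over L₀ such that L₀(t) is elementary over L₀ (i.e. either t ≠ 0 and dt/t = dR for some R ∈ L₀, or dt = dR/R for some R ∈ L₀), let q be algebraic over L₀(t), and set L = L₀(t, q). If a Prelle–Singer relation for Ω holds over L (with v, uᵢ ∈ L and cᵢ ∈ ℂ), then there exist a finite algebraic extension L̃₀ of L₀, elements ṽ ∈ L̃₀, ũᵢ ∈ L̃₀∖{0}, and constants c̃ᵢ ∈ ℂ forming a Prelle–Singer relation for Ω over L̃₀. -/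

import Mathlib

noncomputable section

variable {U : Type} [Field U] [CharZero U] [Algebra ℂ U]

/-- `j`-th coefficient of the one-form  Σᵢ cᵢ duᵢ/uᵢ + dv. -/
def psCoeff {N : ℕ} (D : Fin N → Derivation ℚ U U) {m : ℕ}
    (c u : Fin m → U) (v : U) (j : Fin N) : U :=
  (∑ i, c i * (D j (u i) / u i)) + D j v

/-- Prelle–Singer relation for the (N−1)-form Ω with coefficients `P`:
`(Σᵢ cᵢ duᵢ/uᵢ + dv) ∧ Ω = 0` (the scalar equation `Σⱼ (−1)^j Pⱼ·(coeff j) = 0`)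
and `Σᵢ cᵢ duᵢ/uᵢ + dv ≠ 0`. -/
def IsPSRel {N : ℕ} (D : Fin N → Derivation ℚ U U) (P : Fin N → U) {m : ℕ}
    (c u : Fin m → U) (v : U) : Prop :=
  (∀ i, u i ≠ 0) ∧
  (∑ j : Fin N, (-1 : U) ^ (j : ℕ) * P j * psCoeff D c u v j) = 0 ∧
  (∃ j, psCoeff D c u v j ≠ 0)

/-- One step of an elementary tower: adjoining an exponential, a logarithm, or an
algebraic element. -/
inductive ElemStep {N : ℕ} (D : Fin N → Derivation ℚ U U) :
    IntermediateField ℂ U → IntermediateField ℂ U → Prop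
  | exp (F : IntermediateField ℂ U) (t R : U) (hR : R ∈ F) (ht : t ≠ 0)
      (h : ∀ j, D j t = t * D j R) :
      ElemStep D F (IntermediateField.adjoin ℂ (↑F ∪ {t}))
  | log (F : IntermediateField ℂ U) (t R : U) (hR : R ∈ F) (hR0 : R ≠ 0)
      (h : ∀ j, D j t = D j R / R) :
      ElemStep D F (IntermediateField.adjoin ℂ (↑F ∪ {t}))
  | alg (F : IntermediateField ℂ U) (t : U) (h : IsAlgebraic F t) :
      ElemStep D F (IntermediateField.adjoin ℂ (↑F ∪ {t}))

/-- `F` is an elementary extension of `K`: it is reached from `K` by a finite tower of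
elementary steps and has the same constants as `K`. -/
def IsElementary {N : ℕ} (D : Fin N → Derivation ℚ U U)
    (K F : IntermediateField ℂ U) : Prop :=
  Relation.ReflTransGen (ElemStep D) K F ∧
  ∀ a ∈ F, (∀ j, D j a = 0) → a ∈ K

/-- An additive map satisfying the Leibniz rule. -/
structure IsDerivation {R : Type*} [CommRing R] (d : R → R) : Prop where
  add : ∀ a b, d (a + b) = d a + d b
  mul : ∀ a b, d (a * b) = a * d b + b * d a

namespace IsDerivation

section Ring

variable {R : Type*} [CommRing R] {d : R → R}

lemma one (h : IsDerivation d) : d 1 = 0 := by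
  have := h.mul 1 1
  simpa using this

/-- The bundled derivation over `ℤ` attached to a map satisfying the Leibniz rule. -/
def toDerivation (h : IsDerivation d) : Derivation ℤ R R where
  toFun := d
  map_add' := h.add
  map_smul' n a := by
    exact map_zsmul (AddMonoidHom.mk' d h.add) n a
  map_one_eq_zero' := h.one
  leibniz' := h.mul

lemma zero (h : IsDerivation d) : d 0 = 0 := map_zero h.toDerivation

lemma neg (h : IsDerivation d) (a : R) : d (-a) = -d a := map_neg h.toDerivation a

lemma sub (h : IsDerivation d) (a b : R) : d (a - b) = d a - d b := map_sub h.toDerivation a b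

lemma sum (h : IsDerivation d) {ι : Type*} (s : Finset ι) (f : ι → R) :
    d (∑ i ∈ s, f i) = ∑ i ∈ s, d (f i) := map_sum h.toDerivation f s

lemma intCast (h : IsDerivation d) (n : ℤ) : d n = 0 := h.toDerivation.map_intCast n

lemma pow (h : IsDerivation d) (a : R) (n : ℕ) : d (a ^ n) = n * a ^ (n - 1) * d a := by
  refine (h.toDerivation.leibniz_pow a n).trans ?_
  rw [nsmul_eq_mul, smul_eq_mul, ← mul_assoc]
  rfl

lemma intCast_mul (h : IsDerivation d) (n : ℤ) (a : R) : d (n * a) = n * d a := by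
  rw [h.mul, h.intCast, mul_zero, add_zero]

lemma prod (h : IsDerivation d) {ι : Type*} [DecidableEq ι] (s : Finset ι) (f : ι → R) :
    d (∏ i ∈ s, f i) = ∑ i ∈ s, (∏ k ∈ s.erase i, f k) * d (f i) := by
  induction s using Finset.induction_on with
  | empty => simpa using h.one
  | insert a s ha ih =>
    rw [Finset.prod_insert ha, h.mul, ih, Finset.sum_insert ha, Finset.erase_insert ha,
      Finset.mul_sum, add_comm]
    congr 1
    refine Finset.sum_congr rfl fun i hi => ?_
    have hia : i ≠ a := fun e => ha (e ▸ hi)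
    rw [Finset.erase_insert_of_ne hia.symm, Finset.prod_insert, mul_assoc]
    exact fun hh => ha (Finset.mem_of_mem_erase hh)

/-- The commutator of two derivations is a derivation. -/
lemma commutator {d' : R → R} (h : IsDerivation d) (h' : IsDerivation d') :
    IsDerivation fun a => d (d' a) - d' (d a) where
  add a b := by simp only [h.add, h'.add]; ring
  mul a b := by simp only [h.mul, h'.mul, h.add, h'.add]; ring

lemma sum_mul {ι : Type*} [Fintype ι] {d : ι → R → R} (h : ∀ j, IsDerivation (d j)) (P : ι → R) :
    IsDerivation fun a => ∑ j, P j * d j a where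
  add a b := by simp only [(h _).add, mul_add, Finset.sum_add_distrib]
  mul a b := by
    simp only [(h _).mul, Finset.mul_sum, ← Finset.sum_add_distrib]
    exact Finset.sum_congr rfl fun _ _ => by ring

end Ring

section Field

variable {F : Type*} [Field F] {d : F → F}

lemma inv (h : IsDerivation d) (a : F) : d a⁻¹ = -(a⁻¹ ^ 2 * d a) := by
  refine (h.toDerivation.leibniz_inv a).trans ?_
  rw [smul_eq_mul, neg_mul]
  rfl

lemma div (h : IsDerivation d) {a b : F} (hb : b ≠ 0) : d (a / b) = (d a - a / b * d b) / b := by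
  rw [div_eq_mul_inv, h.mul, h.inv]
  field_simp
  ring

end Field

section Extension

open Polynomial

variable {E M : Type*} [Field E] [Field M] [Algebra E M] {d : E → E} {D : M → M}

lemma map_aeval (hd : IsDerivation d) (hD : IsDerivation D)
    (hc : ∀ f, D (algebraMap E M f) = algebraMap E M (d f)) (x : M) (p : E[X]) :
    ∃ q : E[X], (∀ i, q.coeff i = d (p.coeff i)) ∧
      D (aeval x p) = aeval x q + aeval x (derivative p) * D x := by
  induction p using Polynomial.induction_on' with
  | add p q hp hq =>
    obtain ⟨p', hp1, hp2⟩ := hp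
    obtain ⟨q', hq1, hq2⟩ := hq
    refine ⟨p' + q', fun i => by simp [hp1, hq1, hd.add], ?_⟩
    simp only [map_add, hD.add, hp2, hq2]
    ring
  | monomial n a =>
    refine ⟨monomial n (d a), fun i => ?_, ?_⟩
    · simp only [coeff_monomial]
      split_ifs
      · rfl
      · exact hd.zero.symm
    · simp only [aeval_monomial, derivative_monomial, hD.mul, hc, hD.pow, map_mul, map_natCast]
      ring

variable (hd : IsDerivation d) (hD : IsDerivation D)
  (hc : ∀ f, D (algebraMap E M f) = algebraMap E M (d f))

include hd hD hc

lemma minpoly_coeff_eq_zero {x : M} (hx : IsIntegral E x) (hDx : D x = 0) (i : ℕ) :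
    d ((minpoly E x).coeff i) = 0 := by
  obtain ⟨q, hq, h⟩ := map_aeval hd hD hc x (minpoly E x)
  rw [minpoly.aeval, hD.zero, hDx, mul_zero, add_zero] at h
  have hq0 : q = 0 := by
    by_contra hne
    have hlt : q.degree < (minpoly E x).degree := by
      rw [degree_eq_natDegree (minpoly.ne_zero hx), degree_lt_iff_coeff_zero]
      intro m hm
      rw [hq]
      rcases hm.eq_or_lt with rfl | hm
      · rw [(minpoly.monic hx).coeff_natDegree, hd.one]
      · rw [coeff_eq_zero_of_natDegree_lt hm, hd.zero]
    exact absurd (minpoly.degree_le_of_ne_zero E x hne h.symm) (not_le.mpr hlt)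
  rw [← hq, hq0, coeff_zero]

lemma exists_aeval_div [CharZero E] {x : M} (hx : IsIntegral E x) :
    ∃ q : E[X], (∀ i, q.coeff i = d ((minpoly E x).coeff i)) ∧
      D x = -(aeval x q / aeval x (derivative (minpoly E x))) := by
  obtain ⟨q, hq, h⟩ := map_aeval hd hD hc x (minpoly E x)
  refine ⟨q, hq, ?_⟩
  have h0 : aeval x (derivative (minpoly E x)) ≠ 0 :=
    (minpoly.irreducible hx).separable.aeval_derivative_ne_zero (minpoly.aeval E x)
  rw [minpoly.aeval, hD.zero] at h
  field_simp
  linear_combination -h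

lemma eq_zero_of_minpoly_coeff [CharZero E] {x : M} (hx : IsIntegral E x)
    (h : ∀ i, d ((minpoly E x).coeff i) = 0) : D x = 0 := by
  obtain ⟨q, hq, hDx⟩ := exists_aeval_div hd hD hc hx
  have : q = 0 := by
    ext i
    rw [hq, h, coeff_zero]
  simp [hDx, this]

end Extension

end IsDerivation

namespace IsDerivation

section Trace

open Matrix

lemma det {R : Type*} [CommRing R] {d : R → R} (h : IsDerivation d) {n : Type*} [Fintype n]
    [DecidableEq n] (A : Matrix n n R) : d A.det = (A.adjugate * A.map d).trace := by
  have key : ∀ i, (A.adjugate * A.map d) i i = (A.updateCol i fun k => d (A k i)).det := by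
    intro i
    rw [← cramer_apply, cramer_eq_adjugate_mulVec]
    rfl
  simp only [trace, diag_apply, key, det_apply, h.sum]
  rw [Finset.sum_comm]
  refine Finset.sum_congr rfl fun σ _ => ?_
  have hs : d (Equiv.Perm.sign σ • ∏ i, A (σ i) i) = Equiv.Perm.sign σ • d (∏ i, A (σ i) i) := by
    rcases Int.units_eq_one_or (Equiv.Perm.sign σ) with hσ | hσ <;> simp [hσ, h.neg]
  rw [hs, h.prod, Finset.smul_sum]
  refine Finset.sum_congr rfl fun i _ => ?_
  congr 1
  rw [← Finset.prod_erase_mul _ _ (Finset.mem_univ i)]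
  congr 1
  · refine Finset.prod_congr rfl fun k hk => ?_
    rw [updateCol_ne (Finset.ne_of_mem_erase hk)]
  · rw [updateCol_self]

variable {E M : Type*} [Field E] [Field M] [Algebra E M] [FiniteDimensional E M]
  {d : E → E} {D : M → M} (hd : IsDerivation d) (hD : IsDerivation D)
  (hc : ∀ f, D (algebraMap E M f) = algebraMap E M (d f))

include hd hD hc

omit [FiniteDimensional E M] hd in
lemma exists_leftMulMatrix {n : Type*} [Fintype n] [DecidableEq n] (b : Module.Basis n E M) :
    ∃ B : Matrix n n E, ∀ x, (Algebra.leftMulMatrix b x).map d =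
      Algebra.leftMulMatrix b (D x) + Algebra.leftMulMatrix b x * B
        - B * Algebra.leftMulMatrix b x := by
  refine ⟨Matrix.of fun i j => b.repr (D (b j)) i, fun x => ?_⟩
  have hsmul : ∀ (a : E) (y : M), D (a • y) = a • D y + d a • y := fun a y => by
    simp only [Algebra.smul_def, hD.mul, hc, mul_comm y]
  have hrepr : ∀ y i, b.repr (D y) i =
      d (b.repr y i) + ∑ k, b.repr (D (b k)) i * b.repr y k := by
    intro y i
    conv_lhs => rw [← b.sum_repr y]
    simp only [hD.sum, hsmul]
    simp [map_sum, Finset.sum_add_distrib, Finsupp.single_apply, mul_comm, add_comm]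
  have hmul : ∀ y i, b.repr (x * y) i = ∑ k, b.repr (x * b k) i * b.repr y k := by
    intro y i
    conv_lhs => rw [← b.sum_repr y, Finset.mul_sum]
    simp only [mul_smul_comm]
    simp [map_sum, mul_comm]
  ext i j
  have h1 := hrepr (x * b j) i
  rw [hD.mul, map_add, Finsupp.add_apply, hmul (D (b j))] at h1
  simp only [map_apply, Matrix.sub_apply, Matrix.add_apply, mul_apply, of_apply,
    Algebra.leftMulMatrix_eq_repr_mul]
  rw [mul_comm (b j)] at h1
  linear_combination -h1

lemma trace (x : M) : Algebra.trace E M (D x) = d (Algebra.trace E M x) := by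
  classical
  let b := Module.finBasis E M
  obtain ⟨B, hB⟩ := exists_leftMulMatrix hD hc b
  have h := congrArg Matrix.trace (hB x)
  rw [Matrix.trace_sub, Matrix.trace_add, Matrix.trace_mul_comm _ B, add_sub_cancel_right] at h
  rw [Algebra.trace_eq_matrix_trace b, Algebra.trace_eq_matrix_trace b, ← h]
  simp only [Matrix.trace, diag_apply, map_apply, hd.sum]

lemma norm {x : M} (hx : x ≠ 0) :
    d (Algebra.norm E x) / Algebra.norm E x = Algebra.trace E M (D x / x) := by
  classical
  let b := Module.finBasis E M
  obtain ⟨B, hB⟩ := exists_leftMulMatrix hD hc b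
  have hn : Algebra.norm E x ≠ 0 := Algebra.norm_ne_zero_iff.mpr hx
  set A := Algebra.leftMulMatrix b x with hA
  have hdet : Algebra.norm E x = A.det := Algebra.norm_eq_matrix_det b x
  have hDx : Algebra.leftMulMatrix b (D x) = A * Algebra.leftMulMatrix b (D x / x) := by
    rw [hA, ← map_mul, mul_div_cancel₀ _ hx]
  have hadj : A.adjugate * A = A.det • (1 : Matrix _ _ E) := adjugate_mul A
  have hadj' : A * A.adjugate = A.det • (1 : Matrix _ _ E) := mul_adjugate A
  rw [div_eq_iff hn, hdet, hd.det, hB x, hDx, Matrix.mul_sub, Matrix.mul_add, Matrix.trace_sub,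
    Matrix.trace_add, ← Matrix.mul_assoc, ← Matrix.mul_assoc, ← Matrix.mul_assoc,
    Matrix.trace_mul_cycle A.adjugate B A, hadj, hadj']
  simp [Algebra.trace_eq_matrix_trace b, mul_comm]

end Trace

end IsDerivation

namespace IsDerivation

open TensorProduct in
lemma exists_extension {S T : Type*} [CommRing S] [CommRing T] [Algebra S T]
    [Algebra.FormallyEtale S T] {d : S → S} (hd : IsDerivation d) :
    ∃ D : T → T, IsDerivation D ∧ ∀ s, D (algebraMap S T s) = algebraMap S T (d s) := by
  let d' : Derivation ℤ S S := hd.toDerivation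
  let f : Ω[S⁄ℤ] →ₗ[S] T := (Algebra.linearMap S T).comp d'.liftKaehlerDifferential
  let g : T ⊗[S] Ω[S⁄ℤ] →ₗ[T] T := f.liftBaseChange T
  let e := KaehlerDifferential.tensorKaehlerEquivOfFormallyEtale ℤ S T
  let D : Derivation ℤ T T := (g ∘ₗ e.symm.toLinearMap).compDer (KaehlerDifferential.D ℤ T)
  refine ⟨D, ⟨fun a b => map_add D a b, fun a b => D.leibniz a b⟩, fun s => ?_⟩
  change g (e.symm (KaehlerDifferential.D ℤ T (algebraMap S T s))) = _
  rw [KaehlerDifferential.tensorKaehlerEquivOfFormallyEtale_symm_D_algebraMap]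
  simp only [g, f, LinearMap.liftBaseChange_tmul, one_smul, LinearMap.comp_apply,
    Derivation.liftKaehlerDifferential_comp_D]
  rfl

end IsDerivation

namespace IsDerivation

section Laurent

open scoped LaurentSeries
open Polynomial

variable {A : Type*} [Field A] {δ : A → A}

/-- The derivation of Laurent series which is `δ` on coefficients and sends `X` to
`b * X ^ (e + 1)`. -/
def laurent (hδ : IsDerivation δ) (b : A) (e : ℕ) (y : A⸨X⸩) : A⸨X⸩ :=
  y.map (AddMonoidHom.mk' δ hδ.add) +
    HahnSeries.single ((e : ℤ) + 1) b * LaurentSeries.derivative A y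

lemma coeff_laurent (hδ : IsDerivation δ) (b : A) (e : ℕ) (y : A⸨X⸩) (k : ℤ) :
    (hδ.laurent b e y).coeff k = δ (y.coeff k) + b * ((k - e : ℤ) * y.coeff (k - e)) := by
  rw [laurent, HahnSeries.coeff_add, HahnSeries.coeff_single_mul, HahnSeries.map_coeff,
    LaurentSeries.derivative_apply, LaurentSeries.hasseDeriv_coeff]
  have h1 : k - ((e : ℤ) + 1) + ((1 : ℕ) : ℤ) = k - e := by push_cast; ring
  rw [h1, Ring.choose_one_right, zsmul_eq_mul]
  rfl

lemma laurent_add (hδ : IsDerivation δ) (b : A) (e : ℕ) (y z : A⸨X⸩) :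
    hδ.laurent b e (y + z) = hδ.laurent b e y + hδ.laurent b e z := by
  ext k
  simp only [coeff_laurent, HahnSeries.coeff_add, hδ.add]
  ring

lemma laurent_mul_single (hδ : IsDerivation δ) (b : A) (e : ℕ) (y : A⸨X⸩) (n : ℤ) (a : A) :
    hδ.laurent b e (y * HahnSeries.single n a) =
      y * hδ.laurent b e (HahnSeries.single n a) +
        HahnSeries.single n a * hδ.laurent b e y := by
  have hs : hδ.laurent b e (HahnSeries.single n a) =
      HahnSeries.single n (δ a) + HahnSeries.single (n + e) (b * (n * a)) := by
    ext k
    simp only [coeff_laurent, HahnSeries.coeff_add, HahnSeries.coeff_single]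
    have h2 : k - e = n ↔ k = n + e := sub_eq_iff_eq_add
    simp only [h2]
    congr 1
    · split_ifs
      · rfl
      · exact hδ.zero
    · split_ifs with h
      · subst h; simp
      · simp
  rw [hs]
  ext k
  rw [mul_add, HahnSeries.coeff_add, HahnSeries.coeff_add, mul_comm (HahnSeries.single n a)]
  simp only [coeff_laurent, HahnSeries.coeff_mul_single, hδ.mul]
  rw [show k - (n + (e : ℤ)) = k - n - e by ring, show k - (e : ℤ) - n = k - n - e by ring]
  push_cast
  ring

variable (A) in
/-- The Laurent expansion at `X = 0` of a rational function. -/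
def laurentExpansion : RatFunc A →+* A⸨X⸩ :=
  IsFractionRing.lift (FaithfulSMul.algebraMap_injective A[X] A⸨X⸩)

lemma laurentExpansion_algebraMap (q : A[X]) :
    laurentExpansion A (algebraMap A[X] (RatFunc A) q) = algebraMap A[X] A⸨X⸩ q :=
  IsFractionRing.lift_algebraMap _ _

lemma laurentExpansion_C (a : A) : laurentExpansion A (RatFunc.C a) = HahnSeries.single 0 a := by
  rw [← RatFunc.algebraMap_C, laurentExpansion_algebraMap]
  simp

lemma laurentExpansion_X : laurentExpansion A RatFunc.X = HahnSeries.single 1 1 := by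
  rw [← RatFunc.algebraMap_X, laurentExpansion_algebraMap]
  simp

lemma laurent_mul_polynomial (hδ : IsDerivation δ) (b : A) (e : ℕ) (q : A[X]) (y : A⸨X⸩) :
    hδ.laurent b e (y * laurentExpansion A (algebraMap A[X] (RatFunc A) q)) =
      y * hδ.laurent b e (laurentExpansion A (algebraMap A[X] (RatFunc A) q)) +
        laurentExpansion A (algebraMap A[X] (RatFunc A) q) * hδ.laurent b e y := by
  induction q using Polynomial.induction_on generalizing y with
  | C a => rw [RatFunc.algebraMap_C, laurentExpansion_C, laurent_mul_single]
  | add p q hp hq =>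
    simp only [map_add, mul_add, laurent_add, hp, hq]
    ring
  | monomial n a ih =>
    rw [pow_succ, ← mul_assoc]
    generalize Polynomial.C a * Polynomial.X ^ n = r at ih ⊢
    rw [map_mul, map_mul, RatFunc.algebraMap_X, laurentExpansion_X, ← mul_assoc,
      laurent_mul_single, ih, laurent_mul_single]
    ring

variable {d : RatFunc A → RatFunc A}

lemma laurentExpansion_apply (hδ : IsDerivation δ) (hd : IsDerivation d) {b : A} {e : ℕ}
    (hC : ∀ a, d (RatFunc.C a) = RatFunc.C (δ a))
    (hX : d RatFunc.X = RatFunc.C b * RatFunc.X ^ (e + 1)) (f : RatFunc A) :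
    laurentExpansion A (d f) = hδ.laurent b e (laurentExpansion A f) := by
  have hpoly : ∀ q : A[X], laurentExpansion A (d (algebraMap A[X] (RatFunc A) q)) =
      hδ.laurent b e (laurentExpansion A (algebraMap A[X] (RatFunc A) q)) := by
    intro q
    induction q using Polynomial.induction_on with
    | C a =>
      rw [RatFunc.algebraMap_C, hC, laurentExpansion_C, laurentExpansion_C]
      ext k
      simp only [coeff_laurent, HahnSeries.coeff_single]
      split_ifs with h1 h2 h2
      · simp [h2]
      · simp
      · simp [h2, hδ.zero]
      · simp [hδ.zero]
    | add p q hp hq => simp only [map_add, hd.add, laurent_add, hp, hq]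
    | monomial n a ih =>
      have hX' : laurentExpansion A (d RatFunc.X) =
          hδ.laurent b e (laurentExpansion A RatFunc.X) := by
        rw [hX, map_mul, map_pow, laurentExpansion_C, laurentExpansion_X]
        ext k
        have h2 : k - e = 1 ↔ k = e + 1 := by omega
        simp only [coeff_laurent, HahnSeries.coeff_single, h2, HahnSeries.single_pow,
          HahnSeries.single_mul_single]
        simp only [apply_ite δ, hδ.one, hδ.zero, ite_self, nsmul_eq_mul, Nat.cast_add, Nat.cast_one,
          mul_one, zero_add, one_pow]
        split_ifs with h1
        · subst h1; simp
        · simp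
      rw [pow_succ, ← mul_assoc]
      generalize Polynomial.C a * Polynomial.X ^ n = r at ih ⊢
      rw [map_mul, RatFunc.algebraMap_X, hd.mul, map_add, map_mul,
        map_mul, ih, hX', map_mul]
      rw [laurentExpansion_X, laurent_mul_single]
  obtain ⟨p, q, hq, rfl⟩ := IsFractionRing.div_surjective (A := A[X]) f
  have hq0 : algebraMap A[X] (RatFunc A) q ≠ 0 :=
    IsFractionRing.to_map_ne_zero_of_mem_nonZeroDivisors hq
  set f := algebraMap A[X] (RatFunc A) p / algebraMap A[X] (RatFunc A) q with hf
  have h1 : f * algebraMap A[X] (RatFunc A) q = algebraMap A[X] (RatFunc A) p :=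
    div_mul_cancel₀ _ hq0
  have h2 := hpoly p
  rw [← h1, map_mul, laurent_mul_polynomial, hd.mul, map_add, map_mul, map_mul, hpoly q] at h2
  have h3 : laurentExpansion A (algebraMap A[X] (RatFunc A) q) ≠ 0 := by
    rwa [Ne, map_eq_zero]
  exact mul_left_cancel₀ h3 (add_left_cancel h2)

lemma coeff_laurentExpansion_apply (hδ : IsDerivation δ) (hd : IsDerivation d) {b : A} {e : ℕ}
    (hC : ∀ a, d (RatFunc.C a) = RatFunc.C (δ a))
    (hX : d RatFunc.X = RatFunc.C b * RatFunc.X ^ (e + 1)) (f : RatFunc A) (k : ℤ) :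
    (laurentExpansion A (d f)).coeff k = δ ((laurentExpansion A f).coeff k) +
      b * ((k - e : ℤ) * (laurentExpansion A f).coeff (k - e)) := by
  rw [laurentExpansion_apply hδ hd hC hX, coeff_laurent]

end Laurent

end IsDerivation

/-- The `j`-th component of the form `∑ cᵢ duᵢ/uᵢ + dv`. -/
def logForm {A J : Type*} [Field A] (d : J → A → A) {m : ℕ} (c u : Fin m → A) (v : A) (j : J) :
    A :=
  ∑ i, c i * (d j (u i) / u i) + d j v

/-- There is a nonzero form `∑ cᵢ duᵢ/uᵢ + dv` with constant `cᵢ` which is annihilated by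
the vector `P`. -/
def HasRelation {A J : Type*} [Field A] [Fintype J] (d : J → A → A) (P : J → A) : Prop :=
  ∃ (m : ℕ) (c u : Fin m → A) (v : A), (∀ i j, d j (c i) = 0) ∧ (∀ i, u i ≠ 0) ∧
    ∑ j, P j * logForm d c u v j = 0 ∧ ∃ j, logForm d c u v j ≠ 0

lemma HasRelation.of_logForm_eq {A J : Type*} [Field A] [Fintype J] {d : J → A → A} {P : J → A}
    {m : ℕ} {c u : Fin m → A} {v : A} {ω : J → A} (hc : ∀ i j, d j (c i) = 0) (hu : ∀ i, u i ≠ 0)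
    (hω : ∀ j, logForm d c u v j = ω j) (hP : ∑ j, P j * ω j = 0) (hne : ∃ j, ω j ≠ 0) :
    HasRelation d P :=
  ⟨m, c, u, v, hc, hu, by simpa only [hω] using hP, by simpa only [hω] using hne⟩

namespace IsDerivation

section Coefficients

open scoped LaurentSeries
open Polynomial

variable {A : Type*} [Field A]

lemma coeff_laurentExpansion_C_mul (a : A) (f : RatFunc A) (k : ℤ) :
    (laurentExpansion A (RatFunc.C a * f)).coeff k = a * (laurentExpansion A f).coeff k := by
  rw [map_mul, laurentExpansion_C, HahnSeries.coeff_single_mul, sub_zero]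

lemma coeff_laurentExpansion_C (a : A) (k : ℤ) :
    (laurentExpansion A (RatFunc.C a)).coeff k = if k = 0 then a else 0 := by
  rw [laurentExpansion_C, HahnSeries.coeff_single]
  split_ifs <;> rfl

lemma coeff_laurentExpansion_sum {ι : Type*} (s : Finset ι) (f : ι → RatFunc A) (k : ℤ) :
    (laurentExpansion A (∑ i ∈ s, f i)).coeff k =
      ∑ i ∈ s, (laurentExpansion A (f i)).coeff k := by
  rw [map_sum, HahnSeries.coeff_sum]

lemma exists_coeff_ne_zero {f : RatFunc A} (hf : f ≠ 0) :
    ∃ k, (laurentExpansion A f).coeff k ≠ 0 := by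
  by_contra! h
  exact hf ((map_eq_zero (laurentExpansion A)).mp (HahnSeries.ext (funext h)))

variable {δ : A → A} {d : RatFunc A → RatFunc A}

lemma coeff_logDeriv (hδ : IsDerivation δ) (hd : IsDerivation d) {b : A} {e : ℕ}
    (hC : ∀ a, d (RatFunc.C a) = RatFunc.C (δ a))
    (hX : d RatFunc.X = RatFunc.C b * RatFunc.X ^ (e + 1)) {f : RatFunc A} (hf : f ≠ 0) :
    (∀ k < 0, (laurentExpansion A (d f / f)).coeff k = 0) ∧
      (laurentExpansion A (d f / f)).coeff 0 * (laurentExpansion A f).leadingCoeff =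
        δ (laurentExpansion A f).leadingCoeff +
          b * (((laurentExpansion A f).order - e : ℤ) *
            (laurentExpansion A f).coeff ((laurentExpansion A f).order - e)) := by
  have hcoeff := coeff_laurentExpansion_apply hδ hd hC hX f
  have hmul : laurentExpansion A (d f / f) * laurentExpansion A f = laurentExpansion A (d f) := by
    rw [← map_mul, div_mul_cancel₀ _ hf]
  have hY : laurentExpansion A f ≠ 0 := by rwa [Ne, map_eq_zero]
  set Y := laurentExpansion A f
  set Z := laurentExpansion A (d f / f)
  rw [← hmul] at hcoeff
  have hlow : ∀ k < Y.order, (Z * Y).coeff k = 0 := by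
    intro k hk
    rw [hcoeff, HahnSeries.coeff_eq_zero_of_lt_order hk,
      HahnSeries.coeff_eq_zero_of_lt_order (by omega), hδ.zero]
    simp
  have hZ : ∀ k < 0, Z.coeff k = 0 := by
    intro k hk
    by_contra hne
    have hZ0 : Z.order < 0 := lt_of_le_of_lt (HahnSeries.order_le_of_coeff_ne_zero hne) hk
    have := hlow (Z.order + Y.order) (by omega)
    rw [HahnSeries.coeff_mul_order_add_order, mul_eq_zero, HahnSeries.leadingCoeff_eq_zero,
      HahnSeries.leadingCoeff_eq_zero] at this
    rcases this with h | h
    · simp [h] at hne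
    · exact hY h
  refine ⟨hZ, ?_⟩
  rw [HahnSeries.leadingCoeff_eq, ← hcoeff Y.order]
  rcases eq_or_ne Z 0 with h0 | h0
  · simp [h0]
  have hZo : 0 ≤ Z.order := by
    by_contra! h
    exact h0 (HahnSeries.coeff_order_eq_zero.mp (hZ _ h))
  rcases hZo.eq_or_lt with h | h
  · have := HahnSeries.coeff_mul_order_add_order Z Y
    rw [HahnSeries.leadingCoeff_eq, HahnSeries.leadingCoeff_eq, ← h, zero_add] at this
    exact this.symm
  · rw [HahnSeries.coeff_eq_zero_of_lt_order h, HahnSeries.coeff_eq_zero_of_lt_order (x := Z * Y),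
      zero_mul]
    rw [HahnSeries.order_mul h0 hY]
    omega

lemma eq_C_of_apply_eq_zero [CharZero A] (hd : IsDerivation d) {b : A} (hb : b ≠ 0) {e : ℕ}
    (hC : ∀ a, d (RatFunc.C a) = 0)
    (hX : d RatFunc.X = RatFunc.C b * RatFunc.X ^ (e + 1)) {f : RatFunc A} (hf : d f = 0) :
    ∃ a, f = RatFunc.C a := by
  have hδ : IsDerivation fun _ : A => (0 : A) := ⟨by simp, by simp⟩
  refine ⟨(laurentExpansion A f).coeff 0, (laurentExpansion A).injective ?_⟩
  ext k
  rw [coeff_laurentExpansion_C]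
  split_ifs with hk
  · rw [hk]
  · have := coeff_laurentExpansion_apply hδ hd (by simpa using hC) hX f (k + e)
    rw [hf, map_zero, HahnSeries.coeff_zero, zero_add, add_sub_cancel_right] at this
    simpa [hb, hk] using this.symm

end Coefficients

section Relations

open scoped LaurentSeries

variable {A J : Type*} [Field A] [CharZero A] [Fintype J] {δ : J → A → A}
  {d : J → RatFunc A → RatFunc A} {P : J → A} {R : A}

omit [CharZero A] in
lemma sum_coeff_eq_zero {f : J → RatFunc A}
    (hf : ∑ j, RatFunc.C (P j) * f j = 0) (k : ℤ) :
    ∑ j, P j * (laurentExpansion A (f j)).coeff k = 0 := by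
  have := congrArg (fun g => (laurentExpansion A g).coeff k) hf
  simpa only [coeff_laurentExpansion_sum, coeff_laurentExpansion_C_mul, map_zero,
    HahnSeries.coeff_zero] using this

variable (hδ : ∀ j, IsDerivation (δ j)) (hd : ∀ j, IsDerivation (d j))
  (hC : ∀ j a, d j (RatFunc.C a) = RatFunc.C (δ j a))

include hδ hd hC

omit [CharZero A] in
lemma hasRelation_of_firstIntegral_exp
    (hX : ∀ j, d j RatFunc.X = RatFunc.C (δ j R) * RatFunc.X) {f : RatFunc A}
    (hf : ∑ j, RatFunc.C (P j) * d j f = 0) (hne : ∃ j, d j f ≠ 0) : HasRelation δ P := by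
  have hco := fun j => coeff_laurentExpansion_apply (e := 0) (hδ j) (hd j) (hC j)
    (by simpa using hX j) f
  obtain ⟨j, hj⟩ := hne
  obtain ⟨k, hk⟩ := exists_coeff_ne_zero hj
  have hsum := sum_coeff_eq_zero hf k
  simp only [hco, Nat.cast_zero, sub_zero] at hsum hk
  set a := (laurentExpansion A f).coeff k
  have ha : a ≠ 0 := by
    intro h
    rw [h, (hδ j).zero] at hk
    simp at hk
  have hform : ∀ j, logForm δ (fun _ : Fin 1 => 1) (fun _ => a) (k * R) j =
      (δ j a + δ j R * (k * a)) / a := by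
    intro j
    simp only [logForm, Fin.sum_univ_one, (hδ j).intCast_mul]
    field_simp
  refine .of_logForm_eq (fun i j => (hδ j).one) (fun _ => ha) hform ?_
    ⟨j, div_ne_zero hk ha⟩
  simp only [← mul_div_assoc]
  rw [← Finset.sum_div, hsum, zero_div]

lemma hasRelation_of_order_ne_zero
    (hX : ∀ j, d j RatFunc.X = RatFunc.C (-(δ j R / R)) * RatFunc.X ^ 2) (hR : R ≠ 0)
    (hno : ¬ ∃ w, ∀ j, δ j w = δ j R / R) {f : RatFunc A}
    (hf : ∑ j, RatFunc.C (P j) * d j f = 0) (hf0 : f ≠ 0)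
    (hord : (laurentExpansion A f).order ≠ 0) : HasRelation δ P := by
  have hco := fun j => coeff_laurentExpansion_apply (e := 1) (hδ j) (hd j) (hC j) (hX j) f
  have hsum := sum_coeff_eq_zero hf
  have hY : laurentExpansion A f ≠ 0 := by rwa [Ne, map_eq_zero]
  set Y := laurentExpansion A f
  set p := Y.order
  have hp : Y.coeff p ≠ 0 := by rwa [Ne, HahnSeries.coeff_order_eq_zero]
  have hp1 : Y.coeff (p - 1) = 0 := HahnSeries.coeff_eq_zero_of_lt_order (by omega)
  have h1 := hsum p
  have h2 := hsum (p + 1)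
  simp only [hco, Nat.cast_one, hp1, mul_zero, add_zero, add_sub_cancel_right] at h1 h2
  by_cases hc : ∀ j, δ j (Y.coeff p) = 0
  · have hpA : (p : A) ≠ 0 := by exact_mod_cast hord
    have hform : ∀ j, logForm δ (fun _ : Fin 1 => -(p * Y.coeff p)) (fun _ => R)
        (Y.coeff (p + 1)) j =
          δ j (Y.coeff (p + 1)) + -(δ j R / R) * (p * Y.coeff p) := by
      intro j
      simp only [logForm, Fin.sum_univ_one]
      ring
    refine .of_logForm_eq (fun i j => ?_) (fun _ => hR) hform h2 ?_
    · rw [(hδ j).neg, (hδ j).intCast_mul, hc, mul_zero, neg_zero]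
    · by_contra! h
      refine hno ⟨Y.coeff (p + 1) / (p * Y.coeff p), fun j => ?_⟩
      have hj := h j
      have hpc : (p : A) * Y.coeff p ≠ 0 := mul_ne_zero hpA hp
      rw [(hδ j).div hpc, (hδ j).intCast_mul, hc, mul_zero, mul_zero, sub_zero, div_eq_iff hpc]
      linear_combination hj
  · push Not at hc
    have hform : ∀ j, logForm δ (Fin.elim0 : Fin 0 → A) Fin.elim0 (Y.coeff p) j =
        δ j (Y.coeff p) := by
      intro j
      simp [logForm]
    exact .of_logForm_eq (fun i => i.elim0) (fun i => i.elim0) hform h1 hc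

lemma hasRelation_of_firstIntegral_log
    (hX : ∀ j, d j RatFunc.X = RatFunc.C (-(δ j R / R)) * RatFunc.X ^ 2) (hR : R ≠ 0)
    (hno : ¬ ∃ w, ∀ j, δ j w = δ j R / R) {f : RatFunc A}
    (hf : ∑ j, RatFunc.C (P j) * d j f = 0) (hne : ∃ j, d j f ≠ 0) : HasRelation δ P := by
  have hf0 : f ≠ 0 := by
    rintro rfl
    obtain ⟨j, hj⟩ := hne
    exact hj (hd j).zero
  by_cases hord : (laurentExpansion A f).order = 0
  · set a := (laurentExpansion A f).coeff 0 with ha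
    have hlow : ∀ k < 0, (laurentExpansion A f).coeff k = 0 := fun k hk =>
      HahnSeries.coeff_eq_zero_of_lt_order (by rwa [hord])
    by_cases hc : ∀ j, δ j a = 0
    · have hd' : ∀ j, d j (f - RatFunc.C a) = d j f := fun j => by
        rw [(hd j).sub, hC, hc, map_zero, sub_zero]
      have hg0 : f - RatFunc.C a ≠ 0 := by
        intro h
        obtain ⟨j, hj⟩ := hne
        rw [← hd', h, (hd j).zero] at hj
        exact hj rfl
      refine hasRelation_of_order_ne_zero hδ hd hC hX hR hno (f := f - RatFunc.C a)
        (by simpa only [hd'] using hf) hg0 fun h => ?_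
      have hY : laurentExpansion A (f - RatFunc.C a) ≠ 0 := by rwa [Ne, map_eq_zero]
      apply hY
      rw [← HahnSeries.coeff_order_eq_zero, h, map_sub, HahnSeries.coeff_sub,
        coeff_laurentExpansion_C, if_pos rfl, sub_self]
    · push Not at hc
      have h1 := sum_coeff_eq_zero hf 0
      have hco := fun j => coeff_laurentExpansion_apply (e := 1) (hδ j) (hd j) (hC j) (hX j) f 0
      simp only [hco, hlow (0 - (1 : ℕ)) (by norm_num), mul_zero, add_zero] at h1
      have hform : ∀ j, logForm δ (Fin.elim0 : Fin 0 → A) Fin.elim0 a j = δ j a := by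
        intro j
        simp [logForm]
      exact .of_logForm_eq (fun i => i.elim0) (fun i => i.elim0) hform h1 hc
  · exact hasRelation_of_order_ne_zero hδ hd hC hX hR hno hf hf0 hord

variable {m : ℕ} {c : Fin m → A} {u : Fin m → RatFunc A} {v : RatFunc A} {ω : J → A}

omit [CharZero A] in
lemma hasRelation_of_logForm_exp
    (hX : ∀ j, d j RatFunc.X = RatFunc.C (δ j R) * RatFunc.X)
    (hc : ∀ i j, δ j (c i) = 0) (hu : ∀ i, u i ≠ 0)
    (hω : ∀ j, logForm d (fun i => RatFunc.C (c i)) u v j = RatFunc.C (ω j))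
    (hP : ∑ j, P j * ω j = 0) (hne : ∃ j, ω j ≠ 0) : HasRelation δ P := by
  have hu' : ∀ i, (laurentExpansion A (u i)).leadingCoeff ≠ 0 := fun i => by
    rw [Ne, HahnSeries.leadingCoeff_eq_zero, map_eq_zero]
    exact hu i
  have hform : ∀ j, logForm δ c (fun i => (laurentExpansion A (u i)).leadingCoeff)
      (∑ i, c i * ((laurentExpansion A (u i)).order * R) + (laurentExpansion A v).coeff 0) j
        = ω j := by
    intro j
    have h := congrArg (fun g => (laurentExpansion A g).coeff 0) (hω j)
    have hv := coeff_laurentExpansion_apply (e := 0) (hδ j) (hd j) (hC j) (by simpa using hX j) v 0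
    simp only [logForm, map_add, HahnSeries.coeff_add, coeff_laurentExpansion_sum,
      coeff_laurentExpansion_C_mul, coeff_laurentExpansion_C, if_true, hv] at h
    rw [← h]
    simp only [logForm, (hδ j).add, (hδ j).sum, (hδ j).mul, hc, (hδ j).intCast]
    rw [← add_assoc, ← Finset.sum_add_distrib]
    simp only [Nat.cast_zero, sub_zero, Int.cast_zero, zero_mul, mul_zero, add_zero]
    congr 1
    refine Finset.sum_congr rfl fun i _ => ?_
    have hi := (coeff_logDeriv (e := 0) (hδ j) (hd j) (hC j) (by simpa using hX j) (hu i)).2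
    rw [Nat.cast_zero, sub_zero, ← HahnSeries.leadingCoeff_eq, ← eq_div_iff (hu' i)] at hi
    rw [hi]
    field_simp [hu' i]
  exact .of_logForm_eq hc hu' hform hP hne

lemma hasRelation_of_logForm_log
    (hX : ∀ j, d j RatFunc.X = RatFunc.C (-(δ j R / R)) * RatFunc.X ^ 2) (hR : R ≠ 0)
    (hno : ¬ ∃ w, ∀ j, δ j w = δ j R / R)
    (hc : ∀ i j, δ j (c i) = 0) (hu : ∀ i, u i ≠ 0)
    (hω : ∀ j, logForm d (fun i => RatFunc.C (c i)) u v j = RatFunc.C (ω j))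
    (hP : ∑ j, P j * ω j = 0) (hne : ∃ j, ω j ≠ 0) : HasRelation δ P := by
  have hu' : ∀ i, (laurentExpansion A (u i)).leadingCoeff ≠ 0 := fun i => by
    rw [Ne, HahnSeries.leadingCoeff_eq_zero, map_eq_zero]
    exact hu i
  have hv := fun j => coeff_laurentExpansion_apply (e := 1) (hδ j) (hd j) (hC j) (hX j) v
  have hlog := fun j i => coeff_logDeriv (e := 1) (hδ j) (hd j) (hC j) (hX j) (hu i)
  set V := laurentExpansion A v
  have hneg : ∀ j, ∀ k < 0,
      δ j (V.coeff k) + -(δ j R / R) * ((k - 1 : ℤ) * V.coeff (k - 1)) = 0 := by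
    intro j k hk
    have h := congrArg (fun g => (laurentExpansion A g).coeff k) (hω j)
    simp only [logForm, map_add, HahnSeries.coeff_add, coeff_laurentExpansion_sum,
      coeff_laurentExpansion_C_mul, coeff_laurentExpansion_C, if_neg hk.ne, hv,
      (hlog _ _).1 k hk, mul_zero, Finset.sum_const_zero, zero_add] at h
    exact_mod_cast h
  have hlow : V.coeff (-2) = 0 := by
    by_contra hne2
    have hV : V ≠ 0 := fun h => hne2 (by simp [h])
    have hp : V.coeff V.order ≠ 0 := by rwa [Ne, HahnSeries.coeff_order_eq_zero]
    have hle : V.order ≤ -2 := HahnSeries.order_le_of_coeff_ne_zero hne2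
    set p := V.order
    have hp0 : (p : A) ≠ 0 := by
      have : p ≠ 0 := by omega
      exact_mod_cast this
    have hpc : (p : A) * V.coeff p ≠ 0 := mul_ne_zero hp0 hp
    refine hno ⟨V.coeff (p + 1) / (p * V.coeff p), fun j => ?_⟩
    have h1 := hneg j p (by omega)
    have h2 := hneg j (p + 1) (by omega)
    have hp1 : V.coeff (p - 1) = 0 :=
      HahnSeries.coeff_eq_zero_of_lt_order (show p - 1 < V.order by omega)
    simp only [hp1, mul_zero, add_zero, add_sub_cancel_right] at h1 h2
    rw [(hδ j).div hpc, (hδ j).intCast_mul, h1, mul_zero, mul_zero, sub_zero, div_eq_iff hpc]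
    linear_combination h2
  have hconst : ∀ j, δ j (V.coeff (-1)) = 0 := by
    intro j
    have := hneg j (-1) (by norm_num)
    rw [show (-1 - 1 : ℤ) = -2 by norm_num, hlow] at this
    simpa using this
  have hform : ∀ j, logForm δ (Fin.cons (V.coeff (-1)) c : Fin (m + 1) → A)
      (Fin.cons R fun i => (laurentExpansion A (u i)).leadingCoeff) (V.coeff 0) j = ω j := by
    intro j
    have h := congrArg (fun g => (laurentExpansion A g).coeff 0) (hω j)
    simp only [logForm, map_add, HahnSeries.coeff_add, coeff_laurentExpansion_sum,
      coeff_laurentExpansion_C_mul, coeff_laurentExpansion_C, if_true, hv] at h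
    rw [← h]
    simp only [logForm, Fin.sum_univ_succ, Fin.cons_zero, Fin.cons_succ]
    have hi : ∀ i, (laurentExpansion A (d j (u i) / u i)).coeff 0 =
        δ j (laurentExpansion A (u i)).leadingCoeff / (laurentExpansion A (u i)).leadingCoeff := by
      intro i
      have hi := (hlog j i).2
      have hlt : (laurentExpansion A (u i)).coeff
          ((laurentExpansion A (u i)).order - (1 : ℕ)) = 0 :=
        HahnSeries.coeff_eq_zero_of_lt_order (by simp)
      rw [hlt, mul_zero, mul_zero, add_zero] at hi
      rw [← hi, mul_div_cancel_right₀ _ (hu' i)]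
    simp only [hi]
    simp
    ring
  refine .of_logForm_eq (fun i j => ?_) (fun i => ?_) hform hP hne
  · cases i using Fin.cases with
    | zero => exact hconst j
    | succ i => exact hc i j
  · cases i using Fin.cases with
    | zero => exact hR
    | succ i => exact hu' i

end Relations

end IsDerivation

namespace IsDerivation

lemma commute_logDeriv {F : Type*} [Field F] {d d' : F → F} (h : IsDerivation d)
    (h' : IsDerivation d') (hdd' : ∀ a, d (d' a) = d' (d a)) {u : F} (hu : u ≠ 0) :
    d (d' u / u) = d' (d u / u) := by
  rw [h.div hu, h'.div hu, hdd']
  ring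

lemma commute_logForm {F J J' : Type*} [Field F] {d : J → F → F} {d' : J' → F → F}
    (h : ∀ j, IsDerivation (d j)) (h' : ∀ j, IsDerivation (d' j))
    (hdd' : ∀ j j' a, d j (d' j' a) = d' j' (d j a)) {m : ℕ} {c u : Fin m → F} {v : F}
    (hc : ∀ i j, d j (c i) = 0) (hc' : ∀ i j, d' j (c i) = 0) (hu : ∀ i, u i ≠ 0) (j : J)
    (j' : J') : d j (logForm d' c u v j') = d' j' (logForm d c u v j) := by
  simp only [logForm, (h j).add, (h' j').add, (h j).sum, (h' j').sum, (h j).mul, (h' j').mul, hc,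
    hc', mul_zero, add_zero, hdd', commute_logDeriv (h j) (h' j') (hdd' j j') (hu _)]

section Core

open Polynomial

variable {A : Type*} [Field A]

lemma ratFunc_eq_zero {d : RatFunc A → RatFunc A} (hd : IsDerivation d)
    (hC : ∀ a, d (RatFunc.C a) = 0) (hX : d RatFunc.X = 0) (f : RatFunc A) : d f = 0 := by
  have hpoly : ∀ q : A[X], d (algebraMap A[X] (RatFunc A) q) = 0 := by
    intro q
    induction q using Polynomial.induction_on with
    | C a => rw [RatFunc.algebraMap_C, hC]
    | add p q hp hq => rw [map_add, hd.add, hp, hq, add_zero]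
    | monomial n a ih =>
      rw [pow_succ, ← mul_assoc, map_mul, hd.mul, ih, RatFunc.algebraMap_X, hX, mul_zero,
        mul_zero, add_zero]
  obtain ⟨p, q, hq, rfl⟩ := IsFractionRing.div_surjective (A := A[X]) f
  rw [hd.div (IsFractionRing.to_map_ne_zero_of_mem_nonZeroDivisors hq), hpoly, hpoly, mul_zero,
    sub_zero, zero_div]

variable (A) in
lemma exists_ratFunc (e : ℕ) : ∃ d : RatFunc A → RatFunc A, IsDerivation d ∧
    (∀ a, d (RatFunc.C a) = 0) ∧ d RatFunc.X = RatFunc.X ^ (e + 1) := by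
  have h0 : IsDerivation fun p : A[X] => X ^ (e + 1) * derivative p :=
    ⟨fun a b => by simp [mul_add], fun a b => by simp only [derivative_mul]; ring⟩
  have : Algebra.FormallyEtale A[X] (RatFunc A) :=
    Algebra.FormallyEtale.of_isLocalization (nonZeroDivisors A[X])
  obtain ⟨d, hd, h⟩ := exists_extension (T := RatFunc A) h0
  refine ⟨d, hd, fun a => ?_, ?_⟩
  · rw [← RatFunc.algebraMap_C, h]
    simp
  · rw [← RatFunc.algebraMap_X, h]
    simp

variable {J M : Type*} [CharZero A] [Fintype J] [Field M] [Algebra (RatFunc A) M]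
  [FiniteDimensional (RatFunc A) M]
  {δ : J → A → A} {d : J → RatFunc A → RatFunc A} {D : J → M → M} {P : J → A}

lemma hasRelation_of_finiteDimensional
    (hd : ∀ j, IsDerivation (d j)) (hD : ∀ j, IsDerivation (D j))
    {b : J → A} {e : ℕ} (hC : ∀ j a, d j (RatFunc.C a) = RatFunc.C (δ j a))
    (hX : ∀ j, d j RatFunc.X = RatFunc.C (b j) * RatFunc.X ^ (e + 1))
    (hM : ∀ j f, D j (algebraMap (RatFunc A) M f) = algebraMap (RatFunc A) M (d j f))
    (hclosed : ∀ (z : M) (p : A[X]), p ≠ 0 →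
      p.eval₂ ((algebraMap (RatFunc A) M).comp RatFunc.C) z = 0 →
      ∃ a, z = algebraMap (RatFunc A) M (RatFunc.C a))
    (hFI : ∀ f, ∑ j, RatFunc.C (P j) * d j f = 0 → (∃ j, d j f ≠ 0) → HasRelation δ P)
    (hlog : ∀ (m : ℕ) (c : Fin m → A) (u : Fin m → RatFunc A) (v : RatFunc A) (ω : J → A),
      (∀ i j, δ j (c i) = 0) → (∀ i, u i ≠ 0) →
      (∀ j, logForm d (fun i => RatFunc.C (c i)) u v j = RatFunc.C (ω j)) →
      ∑ j, P j * ω j = 0 → (∃ j, ω j ≠ 0) → HasRelation δ P)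
    {m : ℕ} {c : Fin m → A} {u : Fin m → M} {v : M} (hc : ∀ i j, δ j (c i) = 0)
    (hu : ∀ i, u i ≠ 0)
    (hP : ∑ j, algebraMap (RatFunc A) M (RatFunc.C (P j)) *
      logForm D (fun i => algebraMap (RatFunc A) M (RatFunc.C (c i))) u v j = 0)
    (hne : ∃ j, logForm D (fun i => algebraMap (RatFunc A) M (RatFunc.C (c i))) u v j ≠ 0) :
    HasRelation δ P := by
  have : CharZero (RatFunc A) := charZero_of_injective_algebraMap (RatFunc.C (K := A)).injective
  have hint : ∀ z : M, IsIntegral (RatFunc A) z := fun z => Algebra.IsIntegral.isIntegral z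
  have : Algebra.FormallyEtale (RatFunc A) M := Algebra.FormallyEtale.of_isSeparable _ _
  obtain ⟨ε, hε, hεC, hεX⟩ := exists_ratFunc A e
  obtain ⟨E, hE, hEM⟩ := exists_extension (T := M) hε
  have hcommE : ∀ j f, ε (d j f) = d j (ε f) := by
    intro j f
    rw [← sub_eq_zero]
    refine ratFunc_eq_zero (hε.commutator (hd j)) (fun a => ?_) ?_ f
    · rw [hC, hεC, hεC, (hd j).zero, sub_zero]
    · rw [hX, hεX, hε.mul, hεC, hε.pow, (hd j).pow, hX, hεX]
      ring
  have hcomm : ∀ j z, E (D j z) = D j (E z) := by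
    intro j z
    rw [← sub_eq_zero]
    have h0 : IsDerivation fun _ : RatFunc A => (0 : RatFunc A) := ⟨by simp, by simp⟩
    refine eq_zero_of_minpoly_coeff h0 (hE.commutator (hD j)) (fun f => ?_) (hint z)
      fun i => rfl
    rw [hM, hEM, hEM, hM, hcommE, sub_self, map_zero]
  set φ := (algebraMap (RatFunc A) M).comp (RatFunc.C (K := A)) with hφ
  have hcD : ∀ i j, D j (φ (c i)) = 0 := fun i j => by
    simp only [hφ, RingHom.comp_apply]
    rw [hM, hC, hc, map_zero, map_zero]
  have hφE : ∀ a, E (φ a) = 0 := fun a => by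
    simp only [hφ, RingHom.comp_apply]
    rw [hEM, hεC, map_zero]
  set ω := logForm D (fun i => φ (c i)) u v with hω
  set g := logForm (fun _ : Unit => E) (fun i => φ (c i)) u v () with hg
  have hDg : ∀ j, D j g = E (ω j) := fun j =>
    commute_logForm hD (fun _ => hE) (fun j _ a => (hcomm j a).symm) hcD (fun i _ => hφE _) hu j ()
  have hP' : ∑ j, φ (P j) * ω j = 0 := hP
  by_cases hgc : ∀ j, D j g = 0
  · have hωA : ∀ j, ∃ a, ω j = φ a := by
      intro j
      have hcoeff : ∀ i, ∃ a, (minpoly (RatFunc A) (ω j)).coeff i = RatFunc.C a := fun i =>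
        eq_C_of_apply_eq_zero (e := e) hε one_ne_zero hεC (by rw [hεX, map_one, one_mul])
          (minpoly_coeff_eq_zero hε hE hEM (hint _) (by rw [← hDg, hgc]) i)
      obtain ⟨p, hp⟩ := (lifts_iff_coeff_lifts (f := RatFunc.C (K := A)) _).mpr
        fun i => (hcoeff i).imp fun a ha => ha.symm
      have hp' : p.map (RatFunc.C (K := A)) = minpoly (RatFunc A) (ω j) := hp
      refine hclosed (ω j) p ?_ ?_
      · rintro rfl
        exact minpoly.ne_zero (hint (ω j)) (by rw [← hp', Polynomial.map_zero])
      · rw [← Polynomial.eval₂_map, hp']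
        exact minpoly.aeval _ _
    choose a ha using hωA
    have hn : (Module.finrank (RatFunc A) M : A) ≠ 0 := by
      exact_mod_cast Module.finrank_pos.ne'
    have hφP : ∑ j, P j * a j = 0 := by
      apply φ.injective
      rw [map_sum, map_zero, ← hP']
      exact Finset.sum_congr rfl fun j _ => by rw [map_mul, ha]
    refine hlog m c (fun i => Algebra.norm (RatFunc A) (u i)) (Algebra.trace (RatFunc A) M v)
      (fun j => Module.finrank (RatFunc A) M * a j) hc
      (fun i => Algebra.norm_ne_zero_iff.mpr (hu i)) (fun j => ?_) ?_ ?_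
    · have h := congrArg (Algebra.trace (RatFunc A) M) (ha j)
      have hmul : ∀ (s : A) (z : M), Algebra.trace (RatFunc A) M (φ s * z) =
          RatFunc.C s * Algebra.trace (RatFunc A) M z := by
        intro s z
        rw [show φ s * z = RatFunc.C s • z from (Algebra.smul_def _ _).symm, map_smul, smul_eq_mul]
      rw [hω] at h
      simp only [logForm, map_add, map_sum, hmul] at h
      simp only [logForm, map_mul, map_natCast]
      rw [show φ (a j) = algebraMap (RatFunc A) M (RatFunc.C (a j)) from rfl,
        Algebra.trace_algebraMap, nsmul_eq_mul, trace (hd j) (hD j) (hM j)] at h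
      rw [← h]
      simp only [norm (hd j) (hD j) (hM j) (hu _)]
    · simp only [mul_left_comm _ (Module.finrank (RatFunc A) M : A)]
      rw [← Finset.mul_sum, hφP, mul_zero]
    · obtain ⟨j, hj⟩ := hne
      refine ⟨j, mul_ne_zero hn fun h => hj ?_⟩
      change ω j = 0
      rw [ha, h, map_zero]
  · push Not at hgc
    obtain ⟨j, hj⟩ := hgc
    obtain ⟨i, hi⟩ : ∃ i, d j ((minpoly (RatFunc A) g).coeff i) ≠ 0 := by
      by_contra! h
      exact hj (eq_zero_of_minpoly_coeff (hd j) (hD j) (hM j) (hint g) h)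
    refine hFI _ ?_ ⟨j, hi⟩
    refine minpoly_coeff_eq_zero (sum_mul hd fun j => RatFunc.C (P j))
      (sum_mul hD fun j => φ (P j)) (fun f => ?_) (hint g) ?_ i
    · simp only [hM, map_sum, map_mul]
      rfl
    · simp only [hDg]
      have h := congrArg E hP'
      rw [hE.sum, hE.zero] at h
      rw [← h]
      exact Finset.sum_congr rfl fun j _ => by rw [hE.mul, hφE, mul_zero, add_zero]

end Core

end IsDerivation

namespace IsDerivation

section Restrict

open Polynomial

variable {E L : Type*} [Field E] [Field L] [Algebra E L] {D : L → L}

/-- A derivation preserving a subfield restricts to it. -/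
lemma exists_restrict (hD : IsDerivation D)
    (h : ∀ e, ∃ e', D (algebraMap E L e) = algebraMap E L e') :
    ∃ d : E → E, IsDerivation d ∧ ∀ e, D (algebraMap E L e) = algebraMap E L (d e) := by
  choose d hd using h
  have hinj := (algebraMap E L).injective
  refine ⟨d, ⟨fun a b => hinj ?_, fun a b => hinj ?_⟩, hd⟩
  · rw [← hd, map_add, hD.add, hd, hd, map_add]
  · rw [← hd, map_mul, hD.mul, hd, hd, map_add, map_mul, map_mul]

lemma mem_adjoin_of_isIntegral [CharZero E] (hD : IsDerivation D)
    (h : ∀ e, ∃ e', D (algebraMap E L e) = algebraMap E L e') {t : L} (ht : IsIntegral E t) :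
    D t ∈ IntermediateField.adjoin E {t} := by
  obtain ⟨d, hd, hc⟩ := exists_restrict hD h
  obtain ⟨p, -, hp⟩ := exists_aeval_div hd hD hc ht
  have hm : ∀ p : E[X], aeval t p ∈ IntermediateField.adjoin E {t} := fun p =>
    IntermediateField.algebra_adjoin_le_adjoin E {t} (aeval_mem_adjoin_singleton E t)
  rw [hp]
  exact neg_mem (div_mem (hm _) (hm _))

lemma mem_adjoin (hD : IsDerivation D) {S : Set L}
    (hE : ∀ e, D (algebraMap E L e) ∈ IntermediateField.adjoin E S)
    (hS : ∀ s ∈ S, D s ∈ IntermediateField.adjoin E S) {z : L}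
    (hz : z ∈ IntermediateField.adjoin E S) : D z ∈ IntermediateField.adjoin E S := by
  induction hz using IntermediateField.adjoin_induction with
  | mem s hs => exact hS s hs
  | algebraMap e => exact hE e
  | add a b ha hb iha ihb => rw [hD.add]; exact add_mem iha ihb
  | inv a ha iha => rw [hD.inv]; exact neg_mem (mul_mem (pow_mem (inv_mem ha) 2) iha)
  | mul a b ha hb iha ihb => rw [hD.mul]; exact add_mem (mul_mem ha ihb) (mul_mem hb iha)

/-- The field of constants of a derivation that vanishes on the base field. -/
def constants (hD : IsDerivation D) (hE : ∀ e, D (algebraMap E L e) = 0) :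
    IntermediateField E L where
  carrier := {z | D z = 0}
  mul_mem' {a b} ha hb := by
    change D a = 0 at ha
    change D b = 0 at hb
    change D (a * b) = 0
    rw [hD.mul, ha, hb, mul_zero, mul_zero, add_zero]
  add_mem' {a b} ha hb := by
    change D a = 0 at ha
    change D b = 0 at hb
    change D (a + b) = 0
    rw [hD.add, ha, hb, add_zero]
  algebraMap_mem' := hE
  inv_mem' a ha := by
    change D a = 0 at ha
    change D a⁻¹ = 0
    rw [hD.inv, ha, mul_zero, neg_zero]

lemma eq_zero_of_isIntegral [CharZero E] (hD : IsDerivation D)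
    (hE : ∀ e, D (algebraMap E L e) = 0) {z : L} (hz : IsIntegral E z) : D z = 0 :=
  eq_zero_of_minpoly_coeff (d := fun _ => 0) ⟨by simp, by simp⟩ hD (by simpa using hE) hz
    fun _ => rfl

/-- An element killed by the partial derivatives with respect to a transcendence basis is
algebraic. -/
lemma isAlgebraic_of_mem_adjoin [CharZero E] {ι : Type*} [DecidableEq ι] {x : ι → L}
    {D : ι → L → L} (hD : ∀ i, IsDerivation (D i))
    (hE : ∀ i e, D i (algebraMap E L e) = 0) (hDx : ∀ i j, D i (x j) = if i = j then 1 else 0)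
    {f : L} (hf : IsAlgebraic (Algebra.adjoin E (Set.range x)) f) (hDf : ∀ i, D i f = 0) :
    IsAlgebraic E f := by
  by_contra htr
  have hinj := (algebraMap E L).injective
  have := (faithfulSMul_iff_algebraMap_injective E L).mpr hinj
  let mat := AlgebraicIndependent.matroid E L
  have hIf : mat.Indep {f} := by
    rw [AlgebraicIndependent.matroid_indep_iff]
    exact algebraicIndependent_unique_type_iff.mpr htr
  obtain ⟨I, hI, hfI⟩ := hIf.subset_isBasis_of_subset (X := {f} ∪ Set.range x) (by simp)
    (by simp [mat])
  have hfx : f ∉ Set.range x := by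
    rintro ⟨i, rfl⟩
    have := hDf i
    simp [hDx] at this
  obtain ⟨k, hk⟩ : ∃ k, x k ∉ I := by
    by_contra! hall
    refine hI.indep.notMem_closure_sdiff_of_mem (hfI rfl) ?_
    refine mat.closure_subset_closure (X := Set.range x) ?_ ?_
    · rintro _ ⟨i, rfl⟩
      exact ⟨hall i, fun h => hfx ⟨i, h⟩⟩
    · rw [AlgebraicIndependent.matroid_closure_eq]
      exact hf
  have hI' := (AlgebraicIndependent.matroid_isBasis_iff).mp hI
  let C := constants (hD k) (hE k)
  have hIC : I ⊆ C := by
    intro z hz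
    rcases hI.subset hz with rfl | ⟨i, rfl⟩
    · exact hDf k
    · refine (hDx k i).trans (if_neg ?_)
      rintro rfl
      exact hk hz
  have hle : Algebra.adjoin E I ≤ C.toSubalgebra := Algebra.adjoin_le hIC
  have halg : IsAlgebraic C (x k) := by
    have h := hI'.2.2 (x k) (Or.inr ⟨k, rfl⟩)
    obtain ⟨p, hp, hp0⟩ := h
    refine ⟨p.map (Subalgebra.inclusion hle : Algebra.adjoin E I →+* C.toSubalgebra), ?_, ?_⟩
    · exact (Polynomial.map_ne_zero_iff (Subalgebra.inclusion_injective hle)).mpr hp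
    · rw [aeval_def] at hp0 ⊢
      rw [eval₂_map]
      exact hp0
  have := eq_zero_of_isIntegral (E := C) (hD k) (fun e => e.2) halg.isIntegral
  simp [hDx] at this

end Restrict

end IsDerivation

namespace IsDerivation

section Descent

open Polynomial

variable {A L : Type*} [Field A] [Field L]

lemma exists_apply_ratFunc [Algebra (RatFunc A) L] {D : L → L} (hD : IsDerivation D)
    (hC : ∀ a, ∃ g, D (algebraMap (RatFunc A) L (RatFunc.C a)) = algebraMap (RatFunc A) L g)
    (hX : ∃ g, D (algebraMap (RatFunc A) L RatFunc.X) = algebraMap (RatFunc A) L g)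
    (f : RatFunc A) : ∃ g, D (algebraMap (RatFunc A) L f) = algebraMap (RatFunc A) L g := by
  have hmul : ∀ f f' : RatFunc A,
      (∃ g, D (algebraMap (RatFunc A) L f) = algebraMap (RatFunc A) L g) →
      (∃ g, D (algebraMap (RatFunc A) L f') = algebraMap (RatFunc A) L g) →
      ∃ g, D (algebraMap (RatFunc A) L (f * f')) = algebraMap (RatFunc A) L g := by
    rintro f f' ⟨g, hg⟩ ⟨g', hg'⟩
    exact ⟨f * g' + f' * g, by simp only [map_mul, map_add, hD.mul, hg, hg']⟩
  have hpoly : ∀ p : A[X], ∃ g, D (algebraMap (RatFunc A) L (algebraMap A[X] (RatFunc A) p)) =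
      algebraMap (RatFunc A) L g := by
    intro p
    induction p using Polynomial.induction_on with
    | C a => simpa only [RatFunc.algebraMap_C] using hC a
    | add p q hp hq =>
      obtain ⟨g, hg⟩ := hp
      obtain ⟨g', hg'⟩ := hq
      exact ⟨g + g', by simp only [map_add, hD.add, hg, hg']⟩
    | monomial n a ih =>
      rw [pow_succ, ← mul_assoc, map_mul, RatFunc.algebraMap_X]
      exact hmul _ _ ih hX
  obtain ⟨p, q, hq, rfl⟩ := IsFractionRing.div_surjective (A := A[X]) f
  obtain ⟨g, hg⟩ := hpoly q
  rw [div_eq_mul_inv]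
  exact hmul _ _ (hpoly p) ⟨-((algebraMap A[X] (RatFunc A) q)⁻¹ ^ 2 * g), by
    simp only [map_inv₀, hD.inv, hg, map_neg, map_mul, map_pow]⟩

variable {J : Type*} [Algebra A L] [CharZero A] [Fintype J] {δ : J → A → A}
  {D : J → L → L} {P : J → A}

lemma hasRelation_of_isAlgebraic_ratFunc [Algebra (RatFunc A) L] [IsScalarTower A (RatFunc A) L]
    (hδ : ∀ j, IsDerivation (δ j)) (hD : ∀ j, IsDerivation (D j))
    (hc : ∀ j a, D j (algebraMap A L a) = algebraMap A L (δ j a))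
    (hclosed : ∀ z : L, IsAlgebraic A z → ∃ a, z = algebraMap A L a) {b : J → A} {e : ℕ}
    (hX : ∀ j, D j (algebraMap (RatFunc A) L RatFunc.X) =
      algebraMap A L (b j) * algebraMap (RatFunc A) L RatFunc.X ^ (e + 1))
    (hcase : (e = 0 ∧ ∃ R, ∀ j, b j = δ j R) ∨
      (e = 1 ∧ ∃ R, R ≠ 0 ∧ (¬ ∃ w, ∀ j, δ j w = δ j R / R) ∧ ∀ j, b j = -(δ j R / R)))
    {q : L} (hq : IsAlgebraic (RatFunc A) q) {m : ℕ} {c : Fin m → A} {u : Fin m → L} {v : L}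
    (hc0 : ∀ i j, δ j (c i) = 0) (hu : ∀ i, u i ∈ IntermediateField.adjoin (RatFunc A) {q})
    (hv : v ∈ IntermediateField.adjoin (RatFunc A) {q}) (hu0 : ∀ i, u i ≠ 0)
    (hP : ∑ j, algebraMap A L (P j) * logForm D (fun i => algebraMap A L (c i)) u v j = 0)
    (hne : ∃ j, logForm D (fun i => algebraMap A L (c i)) u v j ≠ 0) :
    HasRelation δ P := by
  have hCL : ∀ a, algebraMap (RatFunc A) L (RatFunc.C a) = algebraMap A L a := fun a =>
    (IsScalarTower.algebraMap_apply A (RatFunc A) L a).symm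
  have hinj := (algebraMap (RatFunc A) L).injective
  have hrat : ∀ j f, ∃ g, D j (algebraMap (RatFunc A) L f) = algebraMap (RatFunc A) L g :=
    fun j => exists_apply_ratFunc (hD j) (fun a => ⟨RatFunc.C (δ j a), by rw [hCL, hc, hCL]⟩)
      ⟨RatFunc.C (b j) * RatFunc.X ^ (e + 1), by rw [hX, map_mul, map_pow, hCL]⟩
  choose d hd hdD using fun j => exists_restrict (hD j) (hrat j)
  have hC : ∀ j a, d j (RatFunc.C a) = RatFunc.C (δ j a) := fun j a => hinj <| by
    rw [← hdD, hCL, hc, hCL]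
  have hdX : ∀ j, d j RatFunc.X = RatFunc.C (b j) * RatFunc.X ^ (e + 1) := fun j => hinj <| by
    rw [← hdD, hX, map_mul, map_pow, hCL]
  have : CharZero (RatFunc A) := charZero_of_injective_algebraMap (RatFunc.C (K := A)).injective
  let M := IntermediateField.adjoin (RatFunc A) {q}
  have : FiniteDimensional (RatFunc A) M :=
    IntermediateField.adjoin.finiteDimensional hq.isIntegral
  have hDM : ∀ j z, z ∈ M → D j z ∈ M := fun j z hz => by
    refine mem_adjoin (hD j) (fun f => ?_) ?_ hz
    · rw [hdD]
      exact M.algebraMap_mem _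
    · rintro _ rfl
      exact mem_adjoin_of_isIntegral (hD j) (hrat j) hq.isIntegral
  let DM : J → M → M := fun j z => ⟨D j z, hDM j z z.2⟩
  have hlf : ∀ j, ((logForm DM (fun i => algebraMap (RatFunc A) M (RatFunc.C (c i)))
      (fun i => (⟨u i, hu i⟩ : M)) ⟨v, hv⟩ j : M) : L) =
      logForm D (fun i => algebraMap A L (c i)) u v j := fun j => by
    simp only [logForm, IntermediateField.coe_add, IntermediateField.coe_sum,
      IntermediateField.coe_mul, IntermediateField.coe_div, DM, ← hCL]
    rfl
  refine hasRelation_of_finiteDimensional (M := M) hd (D := DM) (u := fun i => ⟨u i, hu i⟩)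
    (v := ⟨v, hv⟩) (c := c)
    (fun j => ⟨fun a b => Subtype.ext ((hD j).add a b), fun a b => Subtype.ext ((hD j).mul a b)⟩)
    hC hdX (fun j f => Subtype.ext (hdD j f)) ?_ ?_ ?_ hc0
    (fun i h => hu0 i (congrArg Subtype.val h)) ?_ ?_
  · intro z p hp hz
    have hcomp : (M.val : M →+* L).comp ((algebraMap (RatFunc A) M).comp RatFunc.C) =
        algebraMap A L := RingHom.ext hCL
    have h := congrArg (M.val : M →+* L) hz
    rw [hom_eval₂, hcomp, map_zero] at h
    obtain ⟨a, ha⟩ := hclosed z ⟨p, hp, h⟩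
    exact ⟨a, Subtype.ext (ha.trans (hCL a).symm)⟩
  · intro f hf hne
    rcases hcase with ⟨rfl, R, hR⟩ | ⟨rfl, R, hR0, hno, hR⟩
    · exact hasRelation_of_firstIntegral_exp hδ hd hC
        (fun j => by rw [hdX, hR, zero_add, pow_one]) hf hne
    · exact hasRelation_of_firstIntegral_log hδ hd hC (fun j => by rw [hdX, hR]) hR0 hno hf hne
  · intro m c u v ω hc0 hu hω hP hne
    rcases hcase with ⟨rfl, R, hR⟩ | ⟨rfl, R, hR0, hno, hR⟩
    · exact hasRelation_of_logForm_exp hδ hd hC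
        (fun j => by rw [hdX, hR, zero_add, pow_one]) hc0 hu hω hP hne
    · exact hasRelation_of_logForm_log hδ hd hC (fun j => by rw [hdX, hR]) hR0 hno hc0 hu hω hP hne
  · refine Subtype.ext ?_
    rw [IntermediateField.coe_sum]
    simp only [IntermediateField.coe_mul, hlf]
    refine Eq.trans (Finset.sum_congr rfl fun j _ => ?_) hP
    rw [← hCL]
    rfl
  · obtain ⟨j, hj⟩ := hne
    refine ⟨j, fun h => hj ?_⟩
    rw [← hlf, h, IntermediateField.coe_zero]

end Descent

end IsDerivation

namespace IsDerivation

section Descent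

variable {A L J : Type*} [Field A] [Field L] [Algebra A L] [CharZero A] [Fintype J]
  {δ : J → A → A} {D : J → L → L} {P : J → A}

lemma hasRelation_of_generator (hδ : ∀ j, IsDerivation (δ j)) (hD : ∀ j, IsDerivation (D j))
    (hc : ∀ j a, D j (algebraMap A L a) = algebraMap A L (δ j a))
    (hclosed : ∀ z : L, IsAlgebraic A z → ∃ a, z = algebraMap A L a) {b : J → A} {e : ℕ}
    {s t : L} (hs : Transcendental A s)
    (hst : IntermediateField.adjoin A {s} = IntermediateField.adjoin A {t})
    (hDs : ∀ j, D j s = algebraMap A L (b j) * s ^ (e + 1))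
    (hcase : (e = 0 ∧ ∃ R, ∀ j, b j = δ j R) ∨
      (e = 1 ∧ ∃ R, R ≠ 0 ∧ (¬ ∃ w, ∀ j, δ j w = δ j R / R) ∧ ∀ j, b j = -(δ j R / R)))
    {q : L} (hq : IsAlgebraic (IntermediateField.adjoin A {t}) q) {m : ℕ} {c : Fin m → A}
    {u : Fin m → L} {v : L} (hc0 : ∀ i j, δ j (c i) = 0)
    (hu : ∀ i, u i ∈ IntermediateField.adjoin A {t, q})
    (hv : v ∈ IntermediateField.adjoin A {t, q}) (hu0 : ∀ i, u i ≠ 0)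
    (hP : ∑ j, algebraMap A L (P j) * logForm D (fun i => algebraMap A L (c i)) u v j = 0)
    (hne : ∃ j, logForm D (fun i => algebraMap A L (c i)) u v j ≠ 0) :
    HasRelation δ P := by
  rw [← hst] at hq
  let φ := RatFunc.algEquivOfTranscendental s hs
  let ψ : RatFunc A →ₐ[A] L := (IntermediateField.val _).comp φ.toAlgHom
  let _ : Algebra (RatFunc A) L := ψ.toRingHom.toAlgebra
  have : IsScalarTower A (RatFunc A) L := IsScalarTower.of_algebraMap_eq fun a =>
    (ψ.commutes a).symm
  have hψX : algebraMap (RatFunc A) L RatFunc.X = s := RatFunc.algEquivOfTranscendental_X s hs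
  have hφ : ∀ z ∈ IntermediateField.adjoin A {s}, ∃ f, algebraMap (RatFunc A) L f = z :=
    fun z hz => ⟨φ.symm ⟨z, hz⟩, congrArg Subtype.val (φ.apply_symm_apply ⟨z, hz⟩)⟩
  have hle : ∀ z ∈ IntermediateField.adjoin A {t, q},
      z ∈ IntermediateField.adjoin (RatFunc A) {q} := by
    intro z hz
    suffices h : IntermediateField.adjoin A {t, q} ≤
        (IntermediateField.adjoin (RatFunc A) {q}).restrictScalars A from h hz
    rw [IntermediateField.adjoin_le_iff]
    rintro z (hz | hz)
    · obtain ⟨f, hf⟩ := hφ z <| by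
        rw [hst, hz]
        exact IntermediateField.mem_adjoin_simple_self A t
      exact hf ▸ IntermediateField.algebraMap_mem _ f
    · exact IntermediateField.subset_adjoin (RatFunc A) {q} hz
  have hqR : IsAlgebraic (RatFunc A) q := by
    obtain ⟨p, hp, hp0⟩ := hq
    refine ⟨p.map (φ.symm : _ →+* RatFunc A),
      (Polynomial.map_ne_zero_iff φ.symm.injective).mpr hp, ?_⟩
    rw [Polynomial.aeval_def] at hp0 ⊢
    rw [Polynomial.eval₂_map, ← hp0]
    congr 1
    ext z
    exact congrArg Subtype.val (φ.apply_symm_apply z)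
  exact hasRelation_of_isAlgebraic_ratFunc hδ hD hc hclosed (by rwa [hψX]) hcase hqR hc0
    (fun i => hle _ (hu i)) (hle _ hv) hu0 hP hne

lemma hasRelation_of_exp_or_log (hδ : ∀ j, IsDerivation (δ j)) (hD : ∀ j, IsDerivation (D j))
    (hc : ∀ j a, D j (algebraMap A L a) = algebraMap A L (δ j a))
    (hclosed : ∀ z : L, IsAlgebraic A z → ∃ a, z = algebraMap A L a) {t : L}
    (ht : Transcendental A t)
    (hstep : (∃ R, ∀ j, D j t = t * D j (algebraMap A L R)) ∨
      ∃ R ≠ 0, ∀ j, D j t = D j (algebraMap A L R) / algebraMap A L R)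
    {q : L} (hq : IsAlgebraic (IntermediateField.adjoin A {t}) q) {m : ℕ} {c : Fin m → A}
    {u : Fin m → L} {v : L} (hc0 : ∀ i j, δ j (c i) = 0)
    (hu : ∀ i, u i ∈ IntermediateField.adjoin A {t, q})
    (hv : v ∈ IntermediateField.adjoin A {t, q}) (hu0 : ∀ i, u i ≠ 0)
    (hP : ∑ j, algebraMap A L (P j) * logForm D (fun i => algebraMap A L (c i)) u v j = 0)
    (hne : ∃ j, logForm D (fun i => algebraMap A L (c i)) u v j ≠ 0) :
    HasRelation δ P := by
  have hmem := IntermediateField.mem_adjoin_simple_self (E := L) A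
  rcases hstep with ⟨R, hR⟩ | ⟨R, hR0, hR⟩
  · exact hasRelation_of_generator hδ hD hc hclosed (b := fun j => δ j R) (e := 0) ht rfl
      (fun j => by rw [hR, hc]; ring) (.inl ⟨rfl, R, fun _ => rfl⟩) hq hc0 hu hv hu0 hP hne
  have hR' : ∀ j, D j t = algebraMap A L (δ j R / R) := fun j => by rw [hR, hc, map_div₀]
  by_cases hw : ∃ w, ∀ j, δ j w = δ j R / R
  · obtain ⟨w, hw⟩ := hw
    have hst : IntermediateField.adjoin A {t - algebraMap A L w} =
        IntermediateField.adjoin A {t} := by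
      refine le_antisymm ?_ ?_ <;> rw [IntermediateField.adjoin_simple_le_iff]
      · exact sub_mem (hmem t) (IntermediateField.algebraMap_mem _ w)
      · simpa using add_mem (hmem (t - algebraMap A L w)) (IntermediateField.algebraMap_mem _ w)
    refine hasRelation_of_generator hδ hD hc hclosed (b := fun j => 0) (e := 0) ?_ hst
      (fun j => ?_) (.inl ⟨rfl, 0, fun j => (hδ j).zero.symm⟩) hq hc0 hu hv hu0 hP hne
    · intro h
      refine ht ?_
      simpa using h.add (isAlgebraic_algebraMap w)
    · rw [(hD j).sub, hR', hc, hw, sub_self, map_zero, zero_mul]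
  · have hst : IntermediateField.adjoin A {t⁻¹} = IntermediateField.adjoin A {t} := by
      refine le_antisymm ?_ ?_ <;> rw [IntermediateField.adjoin_simple_le_iff]
      · exact inv_mem (hmem t)
      · simpa using inv_mem (hmem t⁻¹)
    refine hasRelation_of_generator hδ hD hc hclosed (b := fun j => -(δ j R / R)) (e := 1)
      (fun h => ht ?_) hst (fun j => ?_) (.inr ⟨rfl, R, hR0, hw, fun _ => rfl⟩) hq hc0 hu hv hu0
      hP hne
    · simpa using h.inv
    · rw [(hD j).inv, hR', map_neg]
      ring

end Descent

end IsDerivation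

section Elementary

lemma Derivation.isDerivation {U : Type*} [Field U] [CharZero U] (D : Derivation ℚ U U) :
    IsDerivation D :=
  ⟨map_add D, fun a b => by simp⟩

lemma IntermediateField.isAlgebraic_adjoin_of_mem {k U : Type*} [Field k] [Field U] [Algebra k U]
    {S : Set U} {a : U} (ha : a ∈ IntermediateField.adjoin k S) :
    IsAlgebraic (Algebra.adjoin k S) a := by
  induction ha using IntermediateField.adjoin_induction with
  | mem s hs => exact isAlgebraic_algebraMap (⟨s, Algebra.subset_adjoin hs⟩ : Algebra.adjoin k S)
  | algebraMap z => exact isAlgebraic_algebraMap (algebraMap k (Algebra.adjoin k S) z)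
  | add a b _ _ iha ihb => exact iha.add ihb
  | inv a _ iha => exact iha.inv
  | mul a b _ _ iha ihb => exact iha.mul ihb

lemma IsAlgebraic.exists_algebraMap_eq {k U : Type*} [Field k] [IsAlgClosed k] [Field U]
    [Algebra k U] {a : U} (ha : IsAlgebraic k a) : ∃ z, algebraMap k U z = a :=
  minpoly.mem_range_of_degree_eq_one k a
    (IsAlgClosed.degree_eq_one_of_irreducible k (minpoly.irreducible ha.isIntegral))

lemma IntermediateField.mem_adjoin_of_mem_adjoin_union {k U : Type*} [Field k] [Field U]
    [Algebra k U] {F : IntermediateField k U} {A : IntermediateField F U} {T : Set U} {z : U}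
    (hz : z ∈ IntermediateField.adjoin k ((F : Set U) ∪ T)) :
    z ∈ IntermediateField.adjoin A T := by
  have hF : ∀ z ∈ F, z ∈ IntermediateField.adjoin A T := fun z hz =>
    IntermediateField.algebraMap_mem _ (algebraMap F A ⟨z, hz⟩)
  induction hz using IntermediateField.adjoin_induction with
  | mem s hs =>
    rcases hs with hs | hs
    · exact hF s hs
    · exact IntermediateField.subset_adjoin A T hs
  | algebraMap z => exact hF _ (F.algebraMap_mem z)
  | add a b _ _ iha ihb => exact add_mem iha ihb
  | inv a _ iha => exact inv_mem iha
  | mul a b _ _ iha ihb => exact mul_mem iha ihb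

variable {N : ℕ} {D : Fin N → Derivation ℚ U U}

lemma ElemStep.le {F F' : IntermediateField ℂ U} (h : ElemStep D F F') : F ≤ F' := by
  cases h <;> exact fun a ha => IntermediateField.subset_adjoin ℂ _ (Or.inl ha)

lemma ElemStep.apply_mem (hDC : ∀ i (z : ℂ), D i (algebraMap ℂ U z) = 0)
    {F F' : IntermediateField ℂ U} (h : ElemStep D F F') (hF : ∀ j, ∀ a ∈ F, D j a ∈ F) (j : Fin N)
    {a : U} (ha : a ∈ F') : D j a ∈ F' := by
  have key : ∀ t, D j t ∈ IntermediateField.adjoin ℂ ((F : Set U) ∪ {t}) →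
      ∀ a ∈ IntermediateField.adjoin ℂ ((F : Set U) ∪ {t}),
        D j a ∈ IntermediateField.adjoin ℂ ((F : Set U) ∪ {t}) := by
    intro t ht a ha
    refine (D j).isDerivation.mem_adjoin (fun z => ?_) ?_ ha
    · rw [hDC]
      exact zero_mem _
    · rintro s (hs | rfl)
      · exact IntermediateField.subset_adjoin ℂ _ (Or.inl (hF j s hs))
      · exact ht
  have hsub : ∀ t, ∀ a ∈ F, a ∈ IntermediateField.adjoin ℂ ((F : Set U) ∪ {t}) := fun t a ha =>
    IntermediateField.subset_adjoin ℂ _ (Or.inl ha)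
  cases h with
  | exp t R hR ht h =>
    refine key t ?_ a ha
    rw [h]
    exact mul_mem (IntermediateField.subset_adjoin ℂ _ (Or.inr rfl)) (hsub _ _ (hF j R hR))
  | log t R hR hR0 h =>
    refine key t ?_ a ha
    rw [h]
    exact hsub _ _ (div_mem (hF j R hR) hR)
  | alg t h =>
    refine key t ?_ a ha
    have := (D j).isDerivation.mem_adjoin_of_isIntegral (E := F)
      (fun e => ⟨⟨D j e, hF j e e.2⟩, rfl⟩) h.isIntegral
    rw [← IntermediateField.restrictScalars_adjoin]
    exact this

lemma apply_mem_of_reflTransGen (hDC : ∀ i (z : ℂ), D i (algebraMap ℂ U z) = 0)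
    {K F : IntermediateField ℂ U} (h : Relation.ReflTransGen (ElemStep D) K F)
    (hK : ∀ j, ∀ a ∈ K, D j a ∈ K) (j : Fin N) {a : U} (ha : a ∈ F) : D j a ∈ F := by
  induction h generalizing j a with
  | refl => exact hK j a ha
  | tail _ h ih => exact h.apply_mem hDC (fun j a ha => ih j ha) j ha

lemma apply_mem_adjoin_range {x : Fin N → U} (hD : ∀ i j, D i (x j) = if i = j then 1 else 0)
    (hDC : ∀ i (z : ℂ), D i (algebraMap ℂ U z) = 0) (j : Fin N) {a : U}
    (ha : a ∈ IntermediateField.adjoin ℂ (Set.range x)) :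
    D j a ∈ IntermediateField.adjoin ℂ (Set.range x) := by
  refine (D j).isDerivation.mem_adjoin (fun z => ?_) ?_ ha
  · rw [hDC]
    exact zero_mem _
  · rintro _ ⟨i, rfl⟩
    rw [hD]
    split_ifs
    exacts [one_mem _, zero_mem _]

lemma exists_eq_algebraMap_of_isConstant {x : Fin N → U}
    (hD : ∀ i j, D i (x j) = if i = j then 1 else 0)
    (hDC : ∀ i (z : ℂ), D i (algebraMap ℂ U z) = 0) {F : IntermediateField ℂ U}
    (hF : IsElementary D (IntermediateField.adjoin ℂ (Set.range x)) F)
    (hDF : ∀ j, ∀ a ∈ F, D j a ∈ F) {a : U} (ha : IsAlgebraic F a) (hDa : ∀ j, D j a = 0) :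
    ∃ z : ℂ, algebraMap ℂ U z = a := by
  have hconst : ∀ a ∈ F, (∀ j, D j a = 0) → ∃ z : ℂ, algebraMap ℂ U z = a := fun a ha h =>
    (IsDerivation.isAlgebraic_of_mem_adjoin (fun i => (D i).isDerivation) hDC hD
      (IntermediateField.isAlgebraic_adjoin_of_mem (hF.2 a ha h)) h).exists_algebraMap_eq
  have hcoeff : ∀ i, (minpoly F a).coeff i ∈ Set.range (algebraMap ℂ F) := by
    intro i
    obtain ⟨z, hz⟩ := hconst _ ((minpoly F a).coeff i).2 fun j =>
      congrArg Subtype.val <| IsDerivation.minpoly_coeff_eq_zero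
        (d := fun e : F => (⟨D j e, hDF j e e.2⟩ : F))
        ⟨fun a b => Subtype.ext ((D j).isDerivation.add a b),
          fun a b => Subtype.ext ((D j).isDerivation.mul a b)⟩
        (D j).isDerivation (fun _ => rfl) ha.isIntegral (hDa j) i
    exact ⟨z, Subtype.ext hz⟩
  obtain ⟨p, hp⟩ := (Polynomial.lifts_iff_coeff_lifts _).mpr hcoeff
  refine IsAlgebraic.exists_algebraMap_eq ⟨p, ?_, ?_⟩
  · rintro rfl
    exact minpoly.ne_zero ha.isIntegral (by rw [← hp]; simp)
  · rw [← Polynomial.aeval_map_algebraMap F]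
    exact (congrArg (Polynomial.aeval a) hp).trans (minpoly.aeval F a)

end Elementary

/-- Lemma `extensions`. Let L₀ be an elementary extension of
K = ℂ(x₁,…,x_N), let t be transcendental over L₀ with L₀(t) elementary (t an
exponential or a logarithm over L₀), let q be algebraic over L₀(t), and
L = L₀(t,q). A Prelle–Singer relation for Ω over L descends to some finite algebraic
extension of L₀. -/
theorem ps_relation_descends_to_finite_extension
    {N : ℕ} (x : Fin N → U) (D : Fin N → Derivation ℚ U U)
    (hind : AlgebraicIndependent ℂ x)
    (hD : ∀ i j, D i (x j) = if i = j then 1 else 0)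
    (hDC : ∀ i (z : ℂ), D i (algebraMap ℂ U z) = 0)
    (hcomm : ∀ i j a, D i (D j a) = D j (D i a))
    (K : IntermediateField ℂ U) (hK : K = IntermediateField.adjoin ℂ (Set.range x))
    (P : Fin N → U) (hP : ∀ j, P j ∈ K)
    (F0 : IntermediateField ℂ U) (hF0 : IsElementary D K F0)
    (t : U) (ht : Transcendental F0 t)
    (hstep : (t ≠ 0 ∧ ∃ R ∈ F0, ∀ j, D j t = t * D j R) ∨
             (∃ R ∈ F0, R ≠ 0 ∧ ∀ j, D j t = D j R / R))
    (q : U) (hq : IsAlgebraic (IntermediateField.adjoin ℂ ((F0 : Set U) ∪ {t})) q)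
    (F : IntermediateField ℂ U)
    (hF : F = IntermediateField.adjoin ℂ ((F0 : Set U) ∪ {t, q}))
    (m : ℕ) (c : Fin m → ℂ) (u : Fin m → U) (v : U)
    (hu : ∀ i, u i ∈ F) (hv : v ∈ F)
    (hPS : IsPSRel D P (fun i => algebraMap ℂ U (c i)) u v) :
    ∃ Ft : IntermediateField ↥F0 U,
      FiniteDimensional ↥F0 ↥Ft ∧
      ∃ (m' : ℕ) (c' : Fin m' → ℂ) (u' : Fin m' → U) (v' : U),
        (∀ i, u' i ∈ Ft) ∧ v' ∈ Ft ∧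
        IsPSRel D P (fun i => algebraMap ℂ U (c' i)) u' v' := by
  subst hK hF
  have hDF : ∀ j, ∀ a ∈ F0, D j a ∈ F0 := fun j a ha =>
    apply_mem_of_reflTransGen hDC hF0.1 (fun j a ha => apply_mem_adjoin_range hD hDC j ha) j ha
  have hKF : ∀ j, P j ∈ F0 := by
    have hle : ∀ G, Relation.ReflTransGen (ElemStep D)
        (IntermediateField.adjoin ℂ (Set.range x)) G →
        IntermediateField.adjoin ℂ (Set.range x) ≤ G := by
      intro G hG
      induction hG with
      | refl => exact le_rfl
      | tail _ h ih => exact ih.trans h.le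
    exact fun j => hle F0 hF0.1 (hP j)
  let A := algebraicClosure F0 U
  have hA : ∀ {z : U}, z ∈ A ↔ IsAlgebraic F0 z := mem_algebraicClosure_iff
  have hFA : ∀ {z : U}, z ∈ F0 → z ∈ A := fun {z} hz => A.algebraMap_mem ⟨z, hz⟩
  have hDA : ∀ j, ∀ a ∈ A, D j a ∈ A := by
    intro j a ha
    have hle : IntermediateField.adjoin F0 {a} ≤ A :=
      (IntermediateField.adjoin_simple_le_iff).mpr ha
    exact hle ((D j).isDerivation.mem_adjoin_of_isIntegral
      (fun e => ⟨⟨D j e, hDF j e e.2⟩, rfl⟩) (hA.mp ha).isIntegral)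
  have hres : ∀ z : U, IsAlgebraic A z → IsAlgebraic F0 z := fun z hz =>
    hz.restrictScalars F0
  let δ : Fin N → A → A := fun j a => ⟨D j a, hDA j a a.2⟩
  have hδ : ∀ j, IsDerivation (δ j) := fun j =>
    ⟨fun a b => Subtype.ext ((D j).isDerivation.add a b),
      fun a b => Subtype.ext ((D j).isDerivation.mul a b)⟩
  have hCA : ∀ z : ℂ, algebraMap ℂ U z ∈ A := fun z => hFA (F0.algebraMap_mem z)
  obtain ⟨hu0, hsum, hne⟩ := hPS
  obtain ⟨m', c', u', v', hc', hu', hsum', hne'⟩ : HasRelation δ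
      (fun j => (⟨(-1) ^ (j : ℕ) * P j, mul_mem (pow_mem (neg_mem (one_mem A)) _)
        (hFA (hKF j))⟩ : A)) := by
    refine IsDerivation.hasRelation_of_exp_or_log hδ (fun j => (D j).isDerivation)
      (fun j a => rfl) (fun z hz => ⟨⟨z, hA.mpr (hres z hz)⟩, rfl⟩) (fun h => ht (hres t h)) ?_
      (q := q) ?_ (c := fun i => ⟨algebraMap ℂ U (c i), hCA _⟩)
      (fun i j => Subtype.ext (hDC j (c i)))
      (fun i => IntermediateField.mem_adjoin_of_mem_adjoin_union (hu i))
      (IntermediateField.mem_adjoin_of_mem_adjoin_union hv) hu0 hsum hne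
    · rcases hstep with ⟨-, R, hR, h⟩ | ⟨R, hR, hR0, h⟩
      · exact .inl ⟨⟨R, hFA hR⟩, h⟩
      · exact .inr ⟨⟨R, hFA hR⟩, fun h0 => hR0 (congrArg Subtype.val h0), h⟩
    · let g := Subfield.inclusion
        (S := (IntermediateField.adjoin ℂ ((F0 : Set U) ∪ {t})).toSubfield)
        (T := (IntermediateField.adjoin A {t}).toSubfield)
        fun z hz => IntermediateField.mem_adjoin_of_mem_adjoin_union hz
      obtain ⟨p, hp, hp0⟩ := hq
      refine ⟨p.map g, (Polynomial.map_ne_zero_iff g.injective).mpr hp, ?_⟩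
      rw [Polynomial.aeval_def] at hp0 ⊢
      rw [Polynomial.eval₂_map]
      exact hp0
  have hcc : ∀ i, ∃ z : ℂ, algebraMap ℂ U z = c' i := fun i =>
    exists_eq_algebraMap_of_isConstant hD hDC hF0 hDF (hA.mp (c' i).2)
      fun j => congrArg Subtype.val (hc' i j)
  choose c'' hc'' using hcc
  have hform : ∀ j, psCoeff D (fun i => algebraMap ℂ U (c'' i)) (fun i => (u' i : U)) v' j =
      (logForm δ c' u' v' j : A) := by
    intro j
    simp only [psCoeff, logForm, hc'', IntermediateField.coe_add, IntermediateField.coe_sum,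
      IntermediateField.coe_mul, IntermediateField.coe_div, δ]
  let S : Set U := Set.range (fun i => (u' i : U)) ∪ {(v' : U)}
  have hS : ∀ z ∈ S, IsIntegral F0 z := by
    rintro _ (⟨i, rfl⟩ | rfl)
    exacts [(hA.mp (u' i).2).isIntegral, (hA.mp v'.2).isIntegral]
  have : Finite S := ((Set.finite_range _).union (Set.finite_singleton _)).to_subtype
  refine ⟨IntermediateField.adjoin F0 S, IntermediateField.finiteDimensional_adjoin hS, m', c'',
    fun i => u' i, v', fun i => IntermediateField.subset_adjoin _ _ (Or.inl ⟨i, rfl⟩),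
    IntermediateField.subset_adjoin _ _ (Or.inr rfl),
    fun i h => hu' i (Subtype.ext h), ?_, ?_⟩
  · simp only [hform]
    have h := congrArg Subtype.val hsum'
    rw [IntermediateField.coe_sum] at h
    exact h
  · obtain ⟨j, hj⟩ := hne'
    exact ⟨j, fun h => hj (Subtype.ext ((hform j).symm.trans h))⟩
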